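/- Let s = (q⃗, w⃗) ∈ RS(S) be a reachable configuration of the composed system S = S1 ⋈_{H,K} S2 that is an orphan-message configuration for S. Then either the restriction s↾1 is an orphan-message configuration for S1, or s↾2 is an orphan-message configuration for S2. -/

import Mathlib

/- Common formalization of Communicating Finite State Machines (CFSMs),
communicating systems, gateways and their composition, following
"Global Types with Internal Delegation" / GTIR paper definitions. -/

namespace GTIR

/-- Polarity of an action: `!` (send) or `?` (receive). -/
inductive Pol : Type
  | bang
  | query
deriving DecidableEq

/-- Dual polarity: swap `!` and `?`. -/
def Pol.dual : Pol → Pol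
  | .bang => .query
  | .query => .bang

/-- Actions over roles `R` and messages `A`:
`snd s r a` is `sr!a` (s sends `a` to r), `rcv s r a` is `sr?a`
(r receives/consumes `a` sent by s). -/
inductive Act (R A : Type) : Type
  | snd : R → R → A → Act R A
  | rcv : R → R → A → Act R A

/-- The action is a send action. -/
def Act.isSend {R A : Type} : Act R A → Prop
  | .snd _ _ _ => True
  | .rcv _ _ _ => False

/-- The action is a receive action. -/
def Act.isRecv {R A : Type} : Act R A → Prop
  | .snd _ _ _ => False
  | .rcv _ _ _ => True

/-- Erase the channel name of an action: `pq!a ↦ !a`, `pq?a ↦ ?a`. -/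
def Act.noC {R A : Type} : Act R A → Pol × A
  | .snd _ _ a => (.bang, a)
  | .rcv _ _ a => (.query, a)

/-- The dual of a word over `{!,?} × A`: swap `!` and `?` pointwise. -/
def dualWord {A : Type} (w : List (Pol × A)) : List (Pol × A) :=
  w.map fun x => (x.1.dual, x.2)

/-- Universal state type: base states from `B`, plus arbitrarily nested fresh
"hat" states (one for each transition) used by the gateway construction. -/
inductive St (R A B : Type) : Type
  | base : B → St R A B
  | hat : St R A B → Act R A → St R A B → St R A B

/-- A communicating finite state machine over roles `R` and messages `A`,
with states taken from `St R A B`: an initial state together with a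
transition relation. -/
structure CFSM (R A B : Type) where
  init : St R A B
  delta : Set (St R A B × Act R A × St R A B)

namespace CFSM

variable {R A B : Type}

/-- A state is final if it has no outgoing transition. -/
def Final (M : CFSM R A B) (q : St R A B) : Prop :=
  ∀ l q', (q, l, q') ∉ M.delta

/-- A sending state: non-final, and all outgoing transitions are sends. -/
def Sending (M : CFSM R A B) (q : St R A B) : Prop :=
  (∃ l q', (q, l, q') ∈ M.delta) ∧ ∀ l q', (q, l, q') ∈ M.delta → l.isSend

/-- A receiving state: non-final, and all outgoing transitions are receives. -/
def Receiving (M : CFSM R A B) (q : St R A B) : Prop :=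
  (∃ l q', (q, l, q') ∈ M.delta) ∧ ∀ l q', (q, l, q') ∈ M.delta → l.isRecv

/-- A mixed state: it has both an outgoing send and an outgoing receive. -/
def Mixed (M : CFSM R A B) (q : St R A B) : Prop :=
  (∃ l q', (q, l, q') ∈ M.delta ∧ l.isSend) ∧
  (∃ l q', (q, l, q') ∈ M.delta ∧ l.isRecv)

/-- `M` has no mixed states. -/
def NoMixed (M : CFSM R A B) : Prop := ∀ q, ¬ M.Mixed q

/-- `?`-determinism: two receives of the same message from the same state
(possibly on different channels) have the same target. -/
def QDet (M : CFSM R A B) : Prop :=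
  ∀ q a s r s' r' q' q'', (q, Act.rcv s r a, q') ∈ M.delta →
    (q, Act.rcv s' r' a, q'') ∈ M.delta → q' = q''

/-- `!`-determinism: two sends of the same message from the same state
(possibly on different channels) have the same target. -/
def BDet (M : CFSM R A B) : Prop :=
  ∀ q a s r s' r' q' q'', (q, Act.snd s r a, q') ∈ M.delta →
    (q, Act.snd s' r' a, q'') ∈ M.delta → q' = q''

/-- `?!`-determinism. -/
def IODet (M : CFSM R A B) : Prop := M.QDet ∧ M.BDet

/-- Accepting runs from a given state (every state is accepting). -/
inductive Accepts (M : CFSM R A B) : St R A B → List (Act R A) → Prop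
  | nil (q : St R A B) : Accepts M q []
  | cons {q : St R A B} {l : Act R A} {q' : St R A B} {φ : List (Act R A)} :
      (q, l, q') ∈ M.delta → Accepts M q' φ → Accepts M q (l :: φ)

/-- The language of `M` over `Act`. -/
def lang (M : CFSM R A B) : Set (List (Act R A)) := {φ | M.Accepts M.init φ}

/-- The language of `M` with channel names erased. -/
def langNoC (M : CFSM R A B) : Set (List (Pol × A)) :=
  (fun φ => φ.map Act.noC) '' M.lang

/-- Compatibility `M ↔ M'`: the channel-erased language of `M` is the set of
duals of the channel-erased language of `M'`; moreover neither machine has a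
mixed state and both are `?!`-deterministic. -/
def Compat (M M' : CFSM R A B) : Prop :=
  M.langNoC = dualWord '' M'.langNoC ∧
  M.NoMixed ∧ M'.NoMixed ∧ M.IODet ∧ M'.IODet

/-- The machine of role `p` over the role set `P`: every transition label is
an action of `p` (a send `pr!a` or a receive `rp?a`) with partner `r ∈ P`. -/
def ActsFor (M : CFSM R A B) (p : R) (P : Set R) : Prop :=
  ∀ q l q', (q, l, q') ∈ M.delta →
    ∃ r a, r ∈ P ∧ r ≠ p ∧ (l = Act.snd p r a ∨ l = Act.rcv r p a)

/-- All states occurring in `M` are base states; this guarantees that the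
intermediate "hat" states of the gateway construction are fresh for `M`. -/
def HatFree (M : CFSM R A B) : Prop :=
  (∃ b, M.init = St.base b) ∧
  ∀ q l q', (q, l, q') ∈ M.delta →
    (∃ b, q = St.base b) ∧ (∃ b, q' = St.base b)

/-- The set `Q̂` of fresh intermediate gateway states of `M`
(one for each transition of `M`). -/
def hatStates (M : CFSM R A B) : Set (St R A B) :=
  {x | ∃ q l q', (q, l, q') ∈ M.delta ∧ x = St.hat q l q'}

/-- The gateway `gw(M_H, K)` of the machine `M` of role `H` towards role `K`:
each transition `t = (q, Hs!a, q')` of `M` is replaced by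
`(q, KH?a, q̂_t)` and `(q̂_t, Hs!a, q')`, and each transition
`t = (q, sH?a, q')` of `M` is replaced by `(q, sH?a, q̂_t)` and
`(q̂_t, HK!a, q')`. -/
def gw (M : CFSM R A B) (H K : R) : CFSM R A B where
  init := M.init
  delta :=
    {x | ∃ q s a q', (q, Act.snd H s a, q') ∈ M.delta ∧
      (x = (q, Act.rcv K H a, St.hat q (Act.snd H s a) q') ∨
       x = (St.hat q (Act.snd H s a) q', Act.snd H s a, q'))} ∪
    {x | ∃ q s a q', (q, Act.rcv s H a, q') ∈ M.delta ∧
      (x = (q, Act.rcv s H a, St.hat q (Act.rcv s H a) q') ∨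
       x = (St.hat q (Act.rcv s H a) q', Act.snd H K a, q'))}

end CFSM

/-- A communicating system: a set of roles together with a CFSM for each role. -/
structure CS (R A B : Type) where
  roles : Set R
  mach : R → CFSM R A B

namespace CS

variable {R A B : Type}

/-- Well-formedness: the machine of each role `p` of the system only carries
actions of `p` with partners among the system's roles. -/
def WF (S : CS R A B) : Prop :=
  ∀ p ∈ S.roles, (S.mach p).ActsFor p S.roles

/-- Each machine of the system has a finite transition relation
(hence finitely many relevant states). -/
def FiniteSys (S : CS R A B) : Prop :=
  ∀ p ∈ S.roles, (S.mach p).delta.Finite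

open scoped Classical in
/-- Composition `S1 ⋈_{H,K} S2`: the union of the two systems, where the
machines of the interface roles `H` and `K` are replaced by the gateways
`gw(M¹_H, K)` and `gw(M²_K, H)`. -/
noncomputable def compose (S1 S2 : CS R A B) (H K : R) : CS R A B where
  roles := S1.roles ∪ S2.roles
  mach := fun p =>
    if p = H then (S1.mach H).gw H K
    else if p = K then (S2.mach K).gw K H
    else if p ∈ S1.roles then S1.mach p
    else S2.mach p

end CS

/-- A configuration: a local state for every role and a buffer (word over the
messages) for every ordered channel. -/
structure Config (R A B : Type) where
  st : R → St R A B
  buf : R → R → List A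

/-- The initial configuration(s) of a system: every machine of the system is
in its initial state and all the system's buffers are empty. -/
def InitConf {R A B : Type} (S : CS R A B) (c : Config R A B) : Prop :=
  (∀ p ∈ S.roles, c.st p = (S.mach p).init) ∧
  (∀ p ∈ S.roles, ∀ q ∈ S.roles, c.buf p q = [])

/-- One asynchronous step of system `S`, labelled by an action:
a send `sr!a` appends `a` to the buffer of channel `sr`, a receive `sr?a`
removes `a` from the front of the buffer of channel `sr`; everything else is
unchanged. -/
def Step {R A B : Type} (S : CS R A B) (c : Config R A B) :
    Act R A → Config R A B → Prop
  | .snd s r a, c' =>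
      s ∈ S.roles ∧ (c.st s, Act.snd s r a, c'.st s) ∈ (S.mach s).delta ∧
      (∀ p, p ≠ s → c'.st p = c.st p) ∧
      c'.buf s r = c.buf s r ++ [a] ∧
      (∀ p q, ¬(p = s ∧ q = r) → c'.buf p q = c.buf p q)
  | .rcv s r a, c' =>
      r ∈ S.roles ∧ (c.st r, Act.rcv s r a, c'.st r) ∈ (S.mach r).delta ∧
      (∀ p, p ≠ r → c'.st p = c.st p) ∧
      c.buf s r = a :: c'.buf s r ∧
      (∀ p q, ¬(p = s ∧ q = r) → c'.buf p q = c.buf p q)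

/-- `RS(S)`: the configurations reachable from the initial configuration. -/
def Reach {R A B : Type} (S : CS R A B) (c : Config R A B) : Prop :=
  ∃ c₀, InitConf S c₀ ∧
    Relation.ReflTransGen (fun x y => ∃ l, Step S x l y) c₀ c

/-- Deadlock configuration: all the system's buffers are empty and every
machine is in a receiving state. -/
def DeadlockConf {R A B : Type} (S : CS R A B) (c : Config R A B) : Prop :=
  (∀ p ∈ S.roles, ∀ q ∈ S.roles, c.buf p q = []) ∧
  ∀ p ∈ S.roles, (S.mach p).Receiving (c.st p)

/-- A system is deadlock-free if no reachable configuration is a deadlock. -/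
def DeadlockFree {R A B : Type} (S : CS R A B) : Prop :=
  ∀ c, Reach S c → ¬ DeadlockConf S c

/-- Orphan-message configuration: every machine is in a final state but some
buffer of the system is non-empty. -/
def OrphanConf {R A B : Type} (S : CS R A B) (c : Config R A B) : Prop :=
  (∀ p ∈ S.roles, (S.mach p).Final (c.st p)) ∧
  ∃ p ∈ S.roles, ∃ q ∈ S.roles, c.buf p q ≠ []

/-- Unspecified reception configuration: some machine is in a receiving state
but each of its expected input buffers is non-empty and starts with a message
it cannot receive. -/
def UnspecConf {R A B : Type} (S : CS R A B) (c : Config R A B) : Prop :=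
  ∃ r ∈ S.roles, (S.mach r).Receiving (c.st r) ∧
    ∀ s a q', (c.st r, Act.rcv s r a, q') ∈ (S.mach r).delta →
      c.buf s r ≠ [] ∧ ∀ w, c.buf s r ≠ a :: w

/-- A system is safe if no reachable configuration is a deadlock,
an orphan-message, or an unspecified reception configuration. -/
def Safe {R A B : Type} (S : CS R A B) : Prop :=
  ∀ c, Reach S c →
    ¬ DeadlockConf S c ∧ ¬ OrphanConf S c ∧ ¬ UnspecConf S c

end GTIR

open GTIR

namespace Aux

variable {R A B : Type}

def bangs : List (Pol × A) → List A
  | [] => []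
  | (.bang, a) :: w => a :: bangs w
  | (.query, _) :: w => bangs w

def queries : List (Pol × A) → List A
  | [] => []
  | (.bang, _) :: w => queries w
  | (.query, a) :: w => a :: queries w

lemma bangs_append (u v : List (Pol × A)) : bangs (u ++ v) = bangs u ++ bangs v := by
  induction u with
  | nil => rfl
  | cons x u ih => rcases x with ⟨_ | _, a⟩ <;> simp [bangs, ih]

lemma queries_append (u v : List (Pol × A)) : queries (u ++ v) = queries u ++ queries v := by
  induction u with
  | nil => rfl
  | cons x u ih => rcases x with ⟨_ | _, a⟩ <;> simp [queries, ih]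

lemma bangs_dual (u : List (Pol × A)) : bangs (dualWord u) = queries u := by
  induction u with
  | nil => rfl
  | cons x u ih =>
    rcases x with ⟨_ | _, a⟩
    · first | exact ih | exact congrArg (List.cons a) ih
    · first | exact ih | exact congrArg (List.cons a) ih

lemma queries_dual (u : List (Pol × A)) : queries (dualWord u) = bangs u := by
  induction u with
  | nil => rfl
  | cons x u ih =>
    rcases x with ⟨_ | _, a⟩
    · first | exact ih | exact congrArg (List.cons a) ih
    · first | exact ih | exact congrArg (List.cons a) ih

lemma dual_dual (u : List (Pol × A)) : dualWord (dualWord u) = u := by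
  induction u with
  | nil => rfl
  | cons x u ih =>
    unfold dualWord at ih ⊢
    rcases x with ⟨_ | _, a⟩ <;> simp_all [Pol.dual]

lemma dual_append (u v : List (Pol × A)) : dualWord (u ++ v) = dualWord u ++ dualWord v := by
  simp [dualWord]

lemma compare (u v : List (Pol × A)) (hb : bangs u <+: bangs v) (hq : queries v <+: queries u)
    (hp : ∀ x l l' r r', u = x ++ l :: r → v = x ++ l' :: r' → l.1 = l'.1) :
    u <+: v ∨ v <+: u := by
  induction u generalizing v with
  | nil => left; simp
  | cons x u ih =>
    cases v with
    | nil => right; simp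
    | cons y v =>
      have h0 := hp [] x y u v rfl rfl
      have key : x = y ∧ bangs u <+: bangs v ∧ queries v <+: queries u := by
        rcases x with ⟨_ | _, a⟩ <;> rcases y with ⟨_ | _, b⟩ <;>
          simp_all [bangs, queries, List.cons_prefix_cons]
      obtain ⟨rfl, hb', hq'⟩ := key
      have := ih v hb' hq' (fun z l l' r r' h1 h2 => hp (x :: z) l l' r r' (by simp [h1]) (by simp [h2]))
      simpa [List.cons_prefix_cons] using this

inductive Hist (M : CFSM R A B) : St R A B → List (Pol × A) → Prop
  | nil : Hist M M.init []
  | snoc {q l q' w} : Hist M q w → (q, l, q') ∈ M.delta → Hist M q' (w ++ [Act.noC l])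

lemma Hist.nil_inv {M : CFSM R A B} {q} (h : Hist M q []) : q = M.init := by
  generalize hw : ([] : List (Pol × A)) = w at h
  cases h with
  | nil => rfl
  | snoc _ _ => simp at hw

lemma Hist.snoc_inv {M : CFSM R A B} {q w x} (h : Hist M q (w ++ [x])) :
    ∃ q0 l, Hist M q0 w ∧ (q0, l, q) ∈ M.delta ∧ Act.noC l = x := by
  generalize hw : w ++ [x] = w' at h
  cases h with
  | nil => simp at hw
  | snoc h1 h2 =>
    have := List.append_inj' hw rfl
    obtain ⟨rfl, h3⟩ := this
    exact ⟨_, _, h1, h2, by simpa using h3.symm⟩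

lemma Hist.prefix {M : CFSM R A B} {w v} : ∀ {q}, Hist M q (w ++ v) → ∃ q', Hist M q' w := by
  induction v using List.reverseRecOn with
  | nil => intro q h; exact ⟨q, by simpa using h⟩
  | append_singleton v x ih =>
    intro q h
    rw [← List.append_assoc] at h
    obtain ⟨q0, l, h0, _⟩ := h.snoc_inv
    exact ih h0

lemma Hist.det {M : CFSM R A B} (hd : M.IODet) {w} :
    ∀ {q q'}, Hist M q w → Hist M q' w → q = q' := by
  induction w using List.reverseRecOn with
  | nil => intro q q' h h'; rw [h.nil_inv, h'.nil_inv]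
  | append_singleton w x ih =>
    intro q q' h h'
    obtain ⟨q0, l, h0, ht, hl⟩ := h.snoc_inv
    obtain ⟨q1, l', h1, ht', hl'⟩ := h'.snoc_inv
    obtain rfl := ih h0 h1
    subst hl
    rcases l with ⟨s, r, a⟩ | ⟨s, r, a⟩ <;> rcases l' with ⟨s', r', a'⟩ | ⟨s', r', a'⟩ <;>
      simp [Act.noC] at hl' <;> subst hl'
    · exact hd.2 _ _ _ _ _ _ _ _ ht ht'
    · exact hd.1 _ _ _ _ _ _ _ _ ht ht'

lemma Hist.append {M : CFSM R A B} {q φ} (h : M.Accepts q φ) :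
    ∀ {w}, Hist M q w → ∃ q', Hist M q' (w ++ φ.map Act.noC) := by
  induction h with
  | nil q => intro w h; exact ⟨q, by simpa using h⟩
  | cons ht _ ih =>
    intro w h
    simpa using ih (h.snoc ht)

inductive Path (M : CFSM R A B) : St R A B → List (Act R A) → St R A B → Prop
  | nil (q) : Path M q [] q
  | cons {q l q' φ q''} : (q, l, q') ∈ M.delta → Path M q' φ q'' → Path M q (l :: φ) q''

lemma Path.snoc {M : CFSM R A B} {q φ q' l q''} (h : Path M q φ q')
    (ht : (q', l, q'') ∈ M.delta) : Path M q (φ ++ [l]) q'' := by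
  induction h with
  | nil q => exact .cons ht (.nil _)
  | cons h1 _ ih => exact .cons h1 (ih ht)

lemma Path.acc {M : CFSM R A B} {q φ q'} (h : Path M q φ q') : M.Accepts q φ := by
  induction h with
  | nil q => exact .nil _
  | cons h1 _ ih => exact .cons h1 ih

lemma mem_lang_iff {M : CFSM R A B} {w} : w ∈ M.langNoC ↔ ∃ q, Hist M q w := by
  constructor
  · rintro ⟨φ, hφ, rfl⟩
    simpa using Hist.append hφ Hist.nil
  · rintro ⟨q, h⟩
    have : ∃ φ, Path M M.init φ q ∧ φ.map Act.noC = w := by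
      induction h with
      | nil => exact ⟨[], .nil _, rfl⟩
      | snoc _ ht ih =>
        obtain ⟨φ, h1, rfl⟩ := ih
        exact ⟨φ ++ [_], h1.snoc ht, by simp⟩
    obtain ⟨φ, h1, rfl⟩ := this
    exact ⟨φ, h1.acc, rfl⟩

lemma final_no_ext {M : CFSM R A B} (hd : M.IODet) {q w} (h : Hist M q w) (hf : M.Final q)
    {x r} (he : ∃ q', Hist M q' (w ++ x :: r)) : False := by
  obtain ⟨q', he⟩ := he
  have he : Hist M q' ((w ++ [x]) ++ r) := by simpa using he
  obtain ⟨q1, h1⟩ := he.prefix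
  obtain ⟨q0, l, h0, ht, _⟩ := h1.snoc_inv
  obtain rfl := Hist.det hd h h0
  exact hf _ _ ht

lemma same_pol {M : CFSM R A B} (hd : M.IODet) (hm : M.NoMixed) {x l l' r r'}
    (h1 : ∃ q, Hist M q (x ++ l :: r)) (h2 : ∃ q, Hist M q (x ++ l' :: r')) : l.1 = l'.1 := by
  obtain ⟨q, h1⟩ := h1
  obtain ⟨q', h2⟩ := h2
  have h1 : Hist M q ((x ++ [l]) ++ r) := by simpa using h1
  have h2 : Hist M q' ((x ++ [l']) ++ r') := by simpa using h2
  obtain ⟨_, h1⟩ := h1.prefix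
  obtain ⟨_, h2⟩ := h2.prefix
  obtain ⟨q0, k, h0, ht, rfl⟩ := h1.snoc_inv
  obtain ⟨q1, k', h0', ht', rfl⟩ := h2.snoc_inv
  obtain rfl := Hist.det hd h0 h0'
  have := hm q0
  rcases k with ⟨s, r, a⟩ | ⟨s, r, a⟩ <;> rcases k' with ⟨s', r', a'⟩ | ⟨s', r', a'⟩
  · rfl
  · exact (this ⟨⟨_, _, ht, trivial⟩, ⟨_, _, ht', trivial⟩⟩).elim
  · exact (this ⟨⟨_, _, ht', trivial⟩, ⟨_, _, ht, trivial⟩⟩).elim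
  · rfl

lemma core {M1 M2 : CFSM R A B} (hc : M1.Compat M2) {q1 q2 w1 w2}
    (h1 : Hist M1 q1 w1) (h2 : Hist M2 q2 w2) (f1 : M1.Final q1) (f2 : M2.Final q2)
    {b b' : List A} (e1 : queries w1 = bangs w2 ++ b) (e2 : queries w2 = bangs w1 ++ b') :
    b = [] ∧ b' = [] := by
  obtain ⟨hL, hm1, hm2, hd1, hd2⟩ := hc
  have hL1 : ∀ w, (∃ q, Hist M2 q w) → ∃ q, Hist M1 q (dualWord w) := by
    intro w hw
    rw [← mem_lang_iff] at hw ⊢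
    rw [hL]; exact ⟨w, hw, rfl⟩
  have hL2 : ∀ w, (∃ q, Hist M1 q w) → ∃ q, Hist M2 q (dualWord w) := by
    intro w hw
    rw [← mem_lang_iff] at hw ⊢
    rw [hL] at hw
    obtain ⟨v, hv, rfl⟩ := hw
    rwa [dual_dual]
  have hv := hL1 _ ⟨_, h2⟩
  have hcmp := compare w1 (dualWord w2) (by rw [bangs_dual, e2]; simp)
    (by rw [queries_dual, e1]; simp)
    (by
      intro x l l' r r' hu hv'
      exact same_pol hd1 hm1 (r := r) (r' := r') ⟨q1, hu ▸ h1⟩ (hv' ▸ hv))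
  have heq : w1 = dualWord w2 := by
    rcases hcmp with ⟨t, ht⟩ | ⟨t, ht⟩
    · cases t with
      | nil => simpa using ht
      | cons x t => exact (final_no_ext hd1 h1 f1 (x := x) (r := t) (by rw [ht]; exact hv)).elim
    · cases t with
      | nil => simpa using ht.symm
      | cons x t =>
        have h3 := hL2 _ ⟨_, h1⟩
        rw [← ht, dual_append, dual_dual] at h3
        exact (final_no_ext hd2 h2 f2 h3).elim
  subst heq
  rw [queries_dual] at e1
  rw [bangs_dual] at e2
  exact ⟨by simpa using e1, by simpa using e2⟩

inductive GInv (M : CFSM R A B) : St R A B → List A → List A → Prop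
  | base {q w} : Hist M q w → GInv M q (bangs w) (queries w)
  | hsnd {q w s r a q'} : Hist M q w → (q, Act.snd s r a, q') ∈ M.delta →
      GInv M (St.hat q (Act.snd s r a) q') (bangs w ++ [a]) (queries w)
  | hrcv {q w s r a q'} : Hist M q w → (q, Act.rcv s r a, q') ∈ M.delta →
      GInv M (St.hat q (Act.rcv s r a) q') (bangs w) (queries w)

lemma Hist.isBase {M : CFSM R A B} (hf : M.HatFree) {q w} (h : Hist M q w) :
    ∃ b, q = St.base b := by
  cases h with
  | nil => exact hf.1
  | snoc _ ht => exact (hf.2 _ _ _ ht).2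

lemma gstep {M : CFSM R A B} {H K : R} {P : Set R} (hf : M.HatFree) (ha : M.ActsFor H P)
    {g l g'} (h : (g, l, g') ∈ (M.gw H K).delta) {i o} (hG : GInv M g i o) :
    (∃ a, l = Act.rcv K H a ∧ GInv M g' (i ++ [a]) o) ∨
    (∃ a, l = Act.snd H K a ∧ GInv M g' i (o ++ [a])) ∨
    (∃ s ∈ P, ∃ a, (l = Act.rcv s H a ∨ l = Act.snd H s a) ∧ GInv M g' i o) := by
  rcases h with ⟨q, s, a, q', ht, h | h⟩ | ⟨q, s, a, q', ht, h | h⟩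
  · obtain ⟨rfl, rfl, rfl⟩ : g = q ∧ l = _ ∧ g' = _ := by simpa using h
    left
    refine ⟨a, rfl, ?_⟩
    obtain ⟨b, rfl⟩ := (hf.2 _ _ _ ht).1
    cases hG with
    | base hh => exact .hsnd hh ht
  · obtain ⟨rfl, rfl, rfl⟩ : g = _ ∧ l = _ ∧ g' = _ := by simpa using h
    right; right
    obtain ⟨r, a', hr, _, hl | hl⟩ := ha _ _ _ ht
    · cases hl
      refine ⟨s, hr, a, Or.inr rfl, ?_⟩
      cases hG with
      | base hh => obtain ⟨b, hb⟩ := hh.isBase hf; cases hb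
      | hsnd hh _ =>
        have := GInv.base (hh.snoc ht)
        simpa [bangs_append, queries_append, Act.noC, bangs, queries] using this
    · cases hl
  · obtain ⟨rfl, rfl, rfl⟩ : g = q ∧ l = _ ∧ g' = _ := by simpa using h
    right; right
    obtain ⟨r, a', hr, _, hl | hl⟩ := ha _ _ _ ht
    · cases hl
    · cases hl
      refine ⟨s, hr, a, Or.inl rfl, ?_⟩
      obtain ⟨b, rfl⟩ := (hf.2 _ _ _ ht).1
      cases hG with
      | base hh => exact .hrcv hh ht
  · obtain ⟨rfl, rfl, rfl⟩ : g = _ ∧ l = _ ∧ g' = _ := by simpa using h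
    right; left
    refine ⟨a, rfl, ?_⟩
    cases hG with
    | base hh => obtain ⟨b, hb⟩ := hh.isBase hf; cases hb
    | hrcv hh _ =>
      have := GInv.base (hh.snoc ht)
      simpa [bangs_append, queries_append, Act.noC, bangs, queries] using this

lemma gfinal {M : CFSM R A B} {H K : R} {P : Set R} (ha : M.ActsFor H P)
    {g i o} (hG : GInv M g i o) (hfin : (M.gw H K).Final g) :
    M.Final g ∧ ∃ w, Hist M g w ∧ i = bangs w ∧ o = queries w := by
  cases hG with
  | base hh =>
    refine ⟨?_, _, hh, rfl, rfl⟩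
    intro l q' ht
    obtain ⟨r, a, hr, _, rfl | rfl⟩ := ha _ _ _ ht
    · exact hfin _ _ (Or.inl ⟨_, _, _, _, ht, Or.inl rfl⟩)
    · exact hfin _ _ (Or.inr ⟨_, _, _, _, ht, Or.inl rfl⟩)
  | hsnd hh ht =>
    obtain ⟨r, a, hr, _, hl | hl⟩ := ha _ _ _ ht <;> cases hl
    exact (hfin _ _ (Or.inl ⟨_, _, _, _, ht, Or.inr rfl⟩)).elim
  | hrcv hh ht =>
    obtain ⟨r, a, hr, _, hl | hl⟩ := ha _ _ _ ht <;> cases hl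
    exact (hfin _ _ (Or.inr ⟨_, _, _, _, ht, Or.inr rfl⟩)).elim

structure Ctx (S : CS R A B) (P1 P2 : Set R) (H K : R) (M1 M2 : CFSM R A B) : Prop where
  hH : H ∈ P1
  hK : K ∈ P2
  disj : ∀ p, p ∈ P1 → p ∈ P2 → False
  roles : ∀ p, p ∈ S.roles ↔ p ∈ P1 ∨ p ∈ P2
  mH : S.mach H = M1.gw H K
  mK : S.mach K = M2.gw K H
  a1 : ∀ p ∈ P1, p ≠ H → (S.mach p).ActsFor p P1
  a2 : ∀ p ∈ P2, p ≠ K → (S.mach p).ActsFor p P2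
  aH : M1.ActsFor H P1
  aK : M2.ActsFor K P2
  f1 : M1.HatFree
  f2 : M2.HatFree

lemma Ctx.swap {S : CS R A B} {P1 P2 H K M1 M2} (h : Ctx S P1 P2 H K M1 M2) :
    Ctx S P2 P1 K H M2 M1 :=
  ⟨h.hK, h.hH, fun p a b => h.disj p b a, fun p => by rw [h.roles, or_comm], h.mK, h.mH,
    h.a2, h.a1, h.aK, h.aH, h.f2, h.f1⟩

structure Inv (P1 P2 : Set R) (H K : R) (M1 M2 : CFSM R A B) (c : Config R A B) : Prop where
  g : ∃ i1 o1 i2 o2, GInv M1 (c.st H) i1 o1 ∧ GInv M2 (c.st K) i2 o2 ∧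
    o1 = i2 ++ c.buf H K ∧ o2 = i1 ++ c.buf K H
  e1 : ∀ p ∈ P1, ∀ q ∈ P2, ¬ (p = H ∧ q = K) → c.buf p q = []
  e2 : ∀ p ∈ P2, ∀ q ∈ P1, ¬ (p = K ∧ q = H) → c.buf p q = []

lemma Inv.swap {P1 P2 : Set R} {H K} {M1 M2 : CFSM R A B} {c} (h : Inv P1 P2 H K M1 M2 c) :
    Inv P2 P1 K H M2 M1 c := by
  obtain ⟨⟨i1, o1, i2, o2, h1, h2, h3, h4⟩, e1, e2⟩ := h
  exact ⟨⟨i2, o2, i1, o1, h2, h1, h4, h3⟩, e2, e1⟩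

/-- A step inside `P1` not touching gateway histories. -/
lemma inv_local {S : CS R A B} {P1 P2 H K M1 M2} (C : Ctx S P1 P2 H K M1 M2) {c c' : Config R A B}
    (hI : Inv P1 P2 H K M1 M2 c)
    (hG : ∀ i o, GInv M1 (c.st H) i o → GInv M1 (c'.st H) i o) (hK : c'.st K = c.st K)
    {s r : R} (hs : s ∈ P1) (hr : r ∈ P1)
    (hb : ∀ p q, ¬(p = s ∧ q = r) → c'.buf p q = c.buf p q) :
    Inv P1 P2 H K M1 M2 c' := by
  obtain ⟨⟨i1, o1, i2, o2, h1, h2, h3, h4⟩, e1, e2⟩ := hI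
  have hb1 : ∀ p q, q ∈ P2 → c'.buf p q = c.buf p q := fun p q hq =>
    hb p q (fun h => C.disj r hr (h.2 ▸ hq))
  have hb2 : ∀ p q, p ∈ P2 → c'.buf p q = c.buf p q := fun p q hq =>
    hb p q (fun h => C.disj s hs (h.1 ▸ hq))
  refine ⟨⟨i1, o1, i2, o2, hG _ _ h1, hK ▸ h2, ?_, ?_⟩, ?_, ?_⟩
  · rw [hb1 _ _ C.hK]; exact h3
  · rw [hb2 _ _ C.hK]; exact h4
  · intro p hp q hq hn; rw [hb1 _ _ hq]; exact e1 p hp q hq hn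
  · intro p hp q hq hn; rw [hb2 _ _ hp]; exact e2 p hp q hq hn

def actor : Act R A → R
  | .snd s _ _ => s
  | .rcv _ r _ => r

lemma inv_step1 {S : CS R A B} {P1 P2 H K M1 M2} (C : Ctx S P1 P2 H K M1 M2)
    {c c' : Config R A B} {l} (hI : Inv P1 P2 H K M1 M2 c) (hs : Step S c l c')
    (hp : actor l ∈ P1) : Inv P1 P2 H K M1 M2 c' := by
  have hHK : H ≠ K := fun h => C.disj H C.hH (h ▸ C.hK)
  have hst : (c.st (actor l), l, c'.st (actor l)) ∈ (S.mach (actor l)).delta := by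
    cases l <;> exact hs.2.1
  have hoth : ∀ p, p ≠ actor l → c'.st p = c.st p := by
    cases l <;> exact hs.2.2.1
  have hK' : c'.st K = c.st K := hoth K (fun h => C.disj _ hp (h ▸ C.hK))
  by_cases hH : actor l = H
  · rw [hH, C.mH] at hst
    have hI' := hI
    obtain ⟨⟨i1, o1, i2, o2, h1, h2, h3, h4⟩, e1, e2⟩ := hI
    rcases gstep C.f1 C.aH hst h1 with ⟨a, rfl, hg⟩ | ⟨a, rfl, hg⟩ | ⟨s, hsP, a, hl, hg⟩
    · obtain ⟨_, _, _, hb, hbo⟩ := hs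
      refine ⟨⟨_, _, _, _, hg, hK' ▸ h2, ?_, ?_⟩, ?_, ?_⟩
      · rw [hbo _ _ (fun h => hHK h.1)]; exact h3
      · rw [h4, hb]; simp
      · intro p hp q hq hn
        rw [hbo p q (fun h => C.disj K (h.1 ▸ hp) C.hK)]; exact e1 p hp q hq hn
      · intro p hp q hq hn
        rw [hbo _ _ hn]; exact e2 p hp q hq hn
    · obtain ⟨_, _, _, hb, hbo⟩ := hs
      refine ⟨⟨_, _, _, _, hg, hK' ▸ h2, ?_, ?_⟩, ?_, ?_⟩
      · rw [hb, h3]; simp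
      · rw [hbo _ _ (fun h => hHK h.2)]; exact h4
      · intro p hp q hq hn
        rw [hbo _ _ hn]; exact e1 p hp q hq hn
      · intro p hp q hq hn
        rw [hbo p q (fun h => C.disj K (h.2 ▸ hq) C.hK)]; exact e2 p hp q hq hn
    · have hlocal : ∀ s r : R, s ∈ P1 → r ∈ P1 →
          (∀ p q, ¬(p = s ∧ q = r) → c'.buf p q = c.buf p q) → Inv P1 P2 H K M1 M2 c' := by
        intro s r hs hr hb
        have hb1 : c'.buf H K = c.buf H K := hb _ _ (fun h => C.disj r hr (h.2 ▸ C.hK))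
        have hb2 : c'.buf K H = c.buf K H := hb _ _ (fun h => C.disj s hs (h.1 ▸ C.hK))
        refine ⟨⟨i1, o1, i2, o2, hg, hK' ▸ h2, by rw [hb1]; exact h3, by rw [hb2]; exact h4⟩, ?_, ?_⟩
        · intro p hp q hq hn
          rw [hb _ _ (fun h => C.disj r hr (h.2 ▸ hq))]; exact e1 p hp q hq hn
        · intro p hp q hq hn
          rw [hb _ _ (fun h => C.disj s hs (h.1 ▸ hp))]; exact e2 p hp q hq hn
      rcases hl with rfl | rfl
      · exact hlocal s H hsP C.hH hs.2.2.2.2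
      · exact hlocal H s C.hH hsP hs.2.2.2.2
  · obtain ⟨r, a, hr, _, hl⟩ := C.a1 _ hp hH _ _ _ hst
    have hH' : c'.st H = c.st H := hoth H (fun h => hH h.symm)
    have hG : ∀ i o, GInv M1 (c.st H) i o → GInv M1 (c'.st H) i o := by
      intro i o h; rwa [hH']
    generalize hx : actor l = x at *
    rcases hl with rfl | rfl
    · exact inv_local C hI hG hK' hp hr hs.2.2.2.2
    · exact inv_local C hI hG hK' hr hp hs.2.2.2.2

lemma inv_step {S : CS R A B} {P1 P2 H K M1 M2} (C : Ctx S P1 P2 H K M1 M2)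
    {c c' : Config R A B} {l} (hI : Inv P1 P2 H K M1 M2 c) (hs : Step S c l c') :
    Inv P1 P2 H K M1 M2 c' := by
  have : actor l ∈ S.roles := by cases l <;> exact hs.1
  rcases (C.roles _).1 this with h | h
  · exact inv_step1 C hI hs h
  · exact (inv_step1 C.swap hI.swap hs h).swap

lemma inv_init {S : CS R A B} {P1 P2 H K M1 M2} (C : Ctx S P1 P2 H K M1 M2)
    {c : Config R A B} (hi : InitConf S c) : Inv P1 P2 H K M1 M2 c := by
  have r1 : ∀ p ∈ P1, p ∈ S.roles := fun p h => (C.roles p).2 (Or.inl h)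
  have r2 : ∀ p ∈ P2, p ∈ S.roles := fun p h => (C.roles p).2 (Or.inr h)
  refine ⟨⟨[], [], [], [], ?_, ?_, ?_, ?_⟩, ?_, ?_⟩
  · rw [hi.1 H (r1 _ C.hH), C.mH]; exact GInv.base (w := []) Hist.nil
  · rw [hi.1 K (r2 _ C.hK), C.mK]; exact GInv.base (w := []) Hist.nil
  · rw [hi.2 _ (r1 _ C.hH) _ (r2 _ C.hK)]; rfl
  · rw [hi.2 _ (r2 _ C.hK) _ (r1 _ C.hH)]; rfl
  · intro p hp q hq _; exact hi.2 _ (r1 _ hp) _ (r2 _ hq)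
  · intro p hp q hq _; exact hi.2 _ (r2 _ hp) _ (r1 _ hq)

end Aux

/-- a reachable orphan-message configuration of the composed
system restricts to an orphan-message configuration of `S1` or of `S2`.
(Configurations are total functions, and the orphan-message property in `Si`
only constrains the components of `Si`, so the restriction is rendered by
the configuration itself.) -/
theorem stmt9_orphan_restricts
    {R A B : Type} [Finite R] [Finite A]
    (S1 S2 : CS R A B) (H K : R)
    (hH : H ∈ S1.roles) (hK : K ∈ S2.roles)
    (hdisj : S1.roles ∩ S2.roles = ∅)
    (hcompat : (S1.mach H).Compat (S2.mach K))
    (hwf1 : S1.WF) (hwf2 : S2.WF)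
    (hfin1 : S1.FiniteSys) (hfin2 : S2.FiniteSys)
    (hhf1 : (S1.mach H).HatFree) (hhf2 : (S2.mach K).HatFree)
    (c : Config R A B) (hc : Reach (CS.compose S1 S2 H K) c)
    (horphan : OrphanConf (CS.compose S1 S2 H K) c) :
    OrphanConf S1 c ∨ OrphanConf S2 c := by
  have hd : ∀ p, p ∈ S1.roles → p ∈ S2.roles → False := fun p h1 h2 => by
    have : p ∈ S1.roles ∩ S2.roles := ⟨h1, h2⟩
    rw [hdisj] at this; exact this
  have hKH : K ≠ H := fun h => hd H hH (h ▸ hK)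
  have m1 : ∀ p ∈ S1.roles, p ≠ H → (CS.compose S1 S2 H K).mach p = S1.mach p := by
    intro p hp hn
    have : p ≠ K := fun h => hd p hp (h ▸ hK)
    simp [CS.compose, hn, this, hp]
  have m2 : ∀ p ∈ S2.roles, p ≠ K → (CS.compose S1 S2 H K).mach p = S2.mach p := by
    intro p hp hn
    have h1 : p ≠ H := fun h => hd H hH (h ▸ hp)
    have h2 : p ∉ S1.roles := fun h => hd p h hp
    simp [CS.compose, hn, h1, h2]
  have C : Aux.Ctx (CS.compose S1 S2 H K) S1.roles S2.roles H K (S1.mach H) (S2.mach K) :=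
    { hH := hH, hK := hK, disj := hd, roles := fun p => Iff.rfl
      mH := by simp [CS.compose]
      mK := by simp [CS.compose, hKH]
      a1 := fun p hp hn => by rw [m1 p hp hn]; exact hwf1 p hp
      a2 := fun p hp hn => by rw [m2 p hp hn]; exact hwf2 p hp
      aH := hwf1 H hH, aK := hwf2 K hK, f1 := hhf1, f2 := hhf2 }
  have hI : Aux.Inv S1.roles S2.roles H K (S1.mach H) (S2.mach K) c := by
    clear horphan
    obtain ⟨c0, h0, hr⟩ := hc
    induction hr with
    | refl => exact Aux.inv_init C h0
    | tail _ hs ih =>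
      obtain ⟨l, hs⟩ := hs
      exact Aux.inv_step C ih hs
  obtain ⟨⟨i1, o1, i2, o2, g1, g2, b1, b2⟩, e1, e2⟩ := hI
  obtain ⟨hfin, p, hp, q, hq, hne⟩ := horphan
  have fH := hfin H (Or.inl hH)
  have fK := hfin K (Or.inr hK)
  rw [C.mH] at fH
  rw [C.mK] at fK
  obtain ⟨fH, w1, k1, rfl, rfl⟩ := Aux.gfinal C.aH g1 fH
  obtain ⟨fK, w2, k2, rfl, rfl⟩ := Aux.gfinal C.aK g2 fK
  obtain ⟨z1, z2⟩ := Aux.core hcompat k1 k2 fH fK b1 b2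
  have F1 : ∀ p ∈ S1.roles, (S1.mach p).Final (c.st p) := by
    intro p hp
    by_cases h : p = H
    · rw [h]; exact fH
    · rw [← m1 p hp h]; exact hfin p (Or.inl hp)
  have F2 : ∀ p ∈ S2.roles, (S2.mach p).Final (c.st p) := by
    intro p hp
    by_cases h : p = K
    · rw [h]; exact fK
    · rw [← m2 p hp h]; exact hfin p (Or.inr hp)
  rcases hp with hp | hp <;> rcases hq with hq | hq
  · exact Or.inl ⟨F1, p, hp, q, hq, hne⟩
  · by_cases h : p = H ∧ q = K
    · rw [h.1, h.2] at hne; exact (hne z1).elim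
    · exact (hne (e1 p hp q hq h)).elim
  · by_cases h : p = K ∧ q = H
    · rw [h.1, h.2] at hne; exact (hne z2).elim
    · exact (hne (e2 p hp q hq h)).elim
  · exact Or.inr ⟨F2, p, hp, q, hq, hne⟩
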